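/- Take the c-free Fock model with ℋ := 𝔽(I) = ℓ²(List I) (the full Fock space over an index type I with at least 2 elements) and ω := the vacuum vector δ_{[]} of 𝔽(I). Let e₁, e₂ ∈ ℓ²(I) be orthogonal unit vectors and η₁, η₂ ∈ ℓ²(J) orthogonal unit vectors. Then the unital subalgebras of the bounded operators on E generated by π(𝒜(e₁)) ∪ 𝒟(η₁) and by π(𝒜(e₂)) ∪ 𝒟(η₂), respectively, are c-free with respect to the pair of states (φ, ψ). -/

import Mathlib

noncomputable section
open scoped ComplexInnerProductSpace ENNReal
open PowerSeries

/-- Unital subalgebras `A₁, A₂` of a unital associative `ℂ`-algebra are *free* with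
respect to a functional `χ` with `χ 1 = 1`: `χ` vanishes on alternating products of
`χ`-centered elements. -/
def IsFreePair {A : Type*} [Ring A] [Algebra ℂ A] (χ : A → ℂ)
    (A₁ A₂ : Subalgebra ℂ A) : Prop :=
  ∀ (n : ℕ) (ε : Fin n → Fin 2) (x : Fin n → A), 0 < n →
    (∀ j, x j ∈ (if ε j = 0 then A₁ else A₂)) →
    (∀ (j : ℕ) (h : j + 1 < n), ε ⟨j, Nat.lt_of_succ_lt h⟩ ≠ ε ⟨j + 1, h⟩) →
    (∀ j, χ (x j) = 0) →
    χ (List.ofFn x).prod = 0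

/-- Unital subalgebras `A₁, A₂` are *c-free* with respect to the pair `(φ, ψ)`:
they are free with respect to `ψ`, and `φ` is multiplicative on alternating products
of `ψ`-centered elements. -/
def IsCFreePair {A : Type*} [Ring A] [Algebra ℂ A] (φ ψ : A → ℂ)
    (A₁ A₂ : Subalgebra ℂ A) : Prop :=
  IsFreePair ψ A₁ A₂ ∧
  ∀ (n : ℕ) (ε : Fin n → Fin 2) (x : Fin n → A), 0 < n →
    (∀ j, x j ∈ (if ε j = 0 then A₁ else A₂)) →
    (∀ (j : ℕ) (h : j + 1 < n), ε ⟨j, Nat.lt_of_succ_lt h⟩ ≠ ε ⟨j + 1, h⟩) →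
    (∀ j, ψ (x j) = 0) →
    φ (List.ofFn x).prod = ∏ j, φ (x j)

/-- The Hilbert space `E = ℋ ⊕ ℓ²(List J; ℋ)` of the c-free Fock model. -/
abbrev FockE (H : Type*) [NormedAddCommGroup H] [InnerProductSpace ℂ H]
    (J : Type*) : Type _ :=
  WithLp 2 (H × lp (fun _ : List J => H) 2)

section FockModel

variable {H : Type*} [NormedAddCommGroup H] [InnerProductSpace ℂ H]
variable {J : Type*} [DecidableEq J]

/-- The first (ℋ-)component of an element of `E`. -/
def efst (ζ : FockE H J) : H := (WithLp.equiv 2 _ ζ).1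

/-- The second component of an element of `E`, as an ℋ-valued function on words. -/
def esnd (ζ : FockE H J) (w : List J) : H :=
  ((WithLp.equiv 2 _ ζ).2 : ∀ _ : List J, H) w

/-- The distinguished unit vector `Ω = (0, δ_[]·ω)` of `E`. -/
def fockOmega (J : Type*) [DecidableEq J] {H : Type*} [NormedAddCommGroup H]
    [InnerProductSpace ℂ H] (ω : H) : FockE H J :=
  (WithLp.equiv 2 _).symm (0, lp.single 2 ([] : List J) ω)

/-- The unit vector `e_ω = (ω, 0)` of `E`. -/
def fockEOmega (J : Type*) [DecidableEq J] {H : Type*} [NormedAddCommGroup H]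
    [InnerProductSpace ℂ H] (ω : H) : FockE H J :=
  (WithLp.equiv 2 _).symm (ω, 0)

/-- The state `φ(T) = ⟨TΩ, Ω⟩` (inner product ℂ-linear in the first argument, i.e.
`⟪Ω, TΩ⟫` in Mathlib's convention). -/
def fockPhi (J : Type*) [DecidableEq J] {H : Type*} [NormedAddCommGroup H]
    [InnerProductSpace ℂ H] (ω : H) (T : FockE H J →L[ℂ] FockE H J) : ℂ :=
  ⟪fockOmega J ω, T (fockOmega J ω)⟫

/-- The state `ψ(T) = ⟨T e_ω, e_ω⟩`. -/
def fockPsi (J : Type*) [DecidableEq J] {H : Type*} [NormedAddCommGroup H]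
    [InnerProductSpace ℂ H] (ω : H) (T : FockE H J →L[ℂ] FockE H J) : ℂ :=
  ⟪fockEOmega J ω, T (fockEOmega J ω)⟫

/-- `P` is the orthogonal projection `P_Ω` onto `ℂΩ`. -/
def IsProjOmega (ω : H) (P : FockE H J →L[ℂ] FockE H J) : Prop :=
  ∀ ζ : FockE H J, P ζ = ⟪fockOmega J ω, ζ⟫ • fockOmega J ω

/-- `x` is the image `π(a)` of a bounded operator `a` on ℋ under the embedding `π`:
`π(a)(h, F) = (a h', w ↦ a (F' w))` where `(h', F') = (h, F) − ⟨(h,F), Ω⟩·Ω`. -/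
def IsEmbed (ω : H) (a : H →L[ℂ] H) (x : FockE H J →L[ℂ] FockE H J) : Prop :=
  ∀ ζ : FockE H J,
    efst (x ζ) = a (efst (ζ - ⟪fockOmega J ω, ζ⟫ • fockOmega J ω)) ∧
    ∀ w : List J,
      esnd (x ζ) w = a (esnd (ζ - ⟪fockOmega J ω, ζ⟫ • fockOmega J ω) w)

/-- `T` is the creation-type operator `A*_η`: `A*_η(h, F) = (0, G)` with `G [] = 0` and
`G (j :: w) = η j · ⟨F w, ω⟩ · ω`. -/
def IsCre (ω : H) (η : lp (fun _ : J => ℂ) 2) (T : FockE H J →L[ℂ] FockE H J) : Prop :=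
  ∀ ζ : FockE H J, efst (T ζ) = 0 ∧ esnd (T ζ) ([] : List J) = 0 ∧
    ∀ (j : J) (w : List J), esnd (T ζ) (j :: w) = η j • (⟪ω, esnd ζ w⟫ • ω)

/-- `ξ` is the vector `ξ_{η,n} = (0, F_n)`, where `F_n w = η(w₁)⋯η(w_n)·ω` on words of
length `n` and `F_n w = 0` otherwise.  (For `n = 0` this is exactly `Ω`.) -/
def IsXi (ω : H) (η : lp (fun _ : J => ℂ) 2) (n : ℕ) (ξ : FockE H J) : Prop :=
  efst ξ = 0 ∧ ∀ w : List J,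
    esnd ξ w = if w.length = n then (w.map fun j => η j).prod • ω else 0

/-- `T` is the annihilation-type operator `A_{η,n}`: the rank-one operator with
`T ξ_{η,n} = Ω` and `T ζ = 0` for `ζ ⊥ ξ_{η,n}`, i.e. `T ζ = ⟨ζ, ξ_{η,n}⟩·Ω`.
For `n = 0` this is exactly the projection `P_Ω`, as required. -/
def IsAnn (ω : H) (η : lp (fun _ : J => ℂ) 2) (n : ℕ)
    (T : FockE H J →L[ℂ] FockE H J) : Prop :=
  ∃ ξ : FockE H J, IsXi ω η n ξ ∧ ∀ ζ : FockE H J, T ζ = ⟪ξ, ζ⟫ • fockOmega J ω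

end FockModel

/-- The full Fock space `𝔽(ι) = ℓ²(List ι)` over the index type `ι`. -/
abbrev FFock (ι : Type*) : Type _ := lp (fun _ : List ι => ℂ) 2

/-- The vacuum vector `δ_[]` of the full Fock space. -/
def fockVac (ι : Type*) [DecidableEq ι] : FFock ι := lp.single 2 ([] : List ι) (1 : ℂ)

/-- `C` is the creation operator `a*_e`: `(a*_e F) [] = 0` and
`(a*_e F) (j :: w) = e j · F w`. -/
def IsCreF {ι : Type*} (e : lp (fun _ : ι => ℂ) 2) (C : FFock ι →L[ℂ] FFock ι) : Prop :=
  ∀ F : FFock ι, (C F) ([] : List ι) = 0 ∧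
    ∀ (j : ι) (w : List ι), (C F) (j :: w) = e j * F w

/-- The vacuum state `φ(T) = ⟨TΩ, Ω⟩` on bounded operators on the full Fock space. -/
def vacState (ι : Type*) [DecidableEq ι] (T : FFock ι →L[ℂ] FFock ι) : ℂ :=
  ⟪fockVac ι, T (fockVac ι)⟫

section Helpers

lemma tsum_list_cons {α : Type*} (f : List α → ℂ) (a : α → ℂ) (g : List α → ℂ)
    (h0 : f [] = 0) (hc : ∀ j w, f (j :: w) = a j * g w) (ha : Summable a) (hg : Summable g) :
    ∑' w, f w = (∑' j, a j) * ∑' w, g w := by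
  have hinj : Function.Injective (fun p : α × List α => p.1 :: p.2) := by
    rintro ⟨a, b⟩ ⟨c, d⟩ h
    simpa using h
  rw [← hinj.tsum_eq (f := f)]
  · rw [tsum_mul_tsum_of_summable_norm ha.norm hg.norm]
    exact tsum_congr fun p => hc _ _
  · intro w hw
    cases w with
    | nil => exact absurd h0 hw
    | cons j w => exact ⟨(j, w), rfl⟩

lemma creF_inner {ι : Type*} {e e' : lp (fun _ : ι => ℂ) 2} {c c' : FFock ι →L[ℂ] FFock ι}
    (hc : IsCreF e c) (hc' : IsCreF e' c') (F G : FFock ι) :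
    ⟪c F, c' G⟫ = ⟪e, e'⟫ * ⟪F, G⟫ := by
  rw [lp.inner_eq_tsum, lp.inner_eq_tsum, lp.inner_eq_tsum]
  apply tsum_list_cons
  · simp [(hc F).1]
  · intro j w
    simp only [(hc F).2, (hc' G).2, RCLike.inner_apply, map_mul]
    ring
  · exact lp.summable_inner e e'
  · exact lp.summable_inner F G

lemma adj_creF_creF {ι : Type*} {e e' : lp (fun _ : ι => ℂ) 2} {c c' : FFock ι →L[ℂ] FFock ι}
    (hc : IsCreF e c) (hc' : IsCreF e' c') (G : FFock ι) :
    ContinuousLinearMap.adjoint c (c' G) = ⟪e, e'⟫ • G := by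
  refine ext_inner_left ℂ fun F => ?_
  rw [ContinuousLinearMap.adjoint_inner_right, creF_inner hc hc', inner_smul_right]

lemma inner_vac {ι : Type*} [DecidableEq ι] (F : FFock ι) : ⟪fockVac ι, F⟫ = F [] := by
  rw [fockVac, lp.inner_single_left]
  simp

lemma adj_creF_vac {ι : Type*} [DecidableEq ι] {e : lp (fun _ : ι => ℂ) 2}
    {c : FFock ι →L[ℂ] FFock ι} (hc : IsCreF e c) :
    ContinuousLinearMap.adjoint c (fockVac ι) = 0 := by
  refine ext_inner_right ℂ fun F => ?_
  rw [ContinuousLinearMap.adjoint_inner_left, inner_vac, (hc F).1, inner_zero_left]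

/-- Key lemma on the Toeplitz-type algebra. -/
lemma toeplitz_poly {H : Type*} [NormedAddCommGroup H] [InnerProductSpace ℂ H]
    (c d : H →L[ℂ] H) (hdc : ∀ f, d (c f) = f) (a : H →L[ℂ] H)
    (ha : a ∈ Algebra.adjoin ℂ {c, d}) :
    ∀ p : Polynomial ℂ, ∃ q : Polynomial ℂ, ∀ f, d f = 0 →
      a (Polynomial.aeval c p f) = Polynomial.aeval c q f := by
  induction ha using Algebra.adjoin_induction with
  | mem x hx =>
    intro p
    rcases hx with rfl | hx
    · refine ⟨Polynomial.X * p, fun f _ => ?_⟩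
      simp
    · obtain rfl : x = d := hx
      refine ⟨p.divX, fun f hf => ?_⟩
      have key : Polynomial.aeval c p f
          = c (Polynomial.aeval c p.divX f) + p.coeff 0 • f := by
        have h := congrArg (fun r => Polynomial.aeval c r f) (Polynomial.X_mul_divX_add p)
        simp only [map_add, map_mul, Polynomial.aeval_X, Polynomial.aeval_C,
          Algebra.algebraMap_eq_smul_one, ContinuousLinearMap.add_apply,
          ContinuousLinearMap.mul_apply, ContinuousLinearMap.smul_apply,
          ContinuousLinearMap.one_apply] at h
        exact h.symm
      rw [key, map_add, map_smul, hdc, hf, smul_zero, add_zero]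
  | algebraMap r =>
    intro p
    refine ⟨Polynomial.C r * p, fun f _ => ?_⟩
    simp
  | add x y _ _ hx hy =>
    intro p
    obtain ⟨q, hq⟩ := hx p
    obtain ⟨q', hq'⟩ := hy p
    exact ⟨q + q', fun f hf => by simp [hq f hf, hq' f hf]⟩
  | mul x y _ _ hx hy =>
    intro p
    obtain ⟨q, hq⟩ := hy p
    obtain ⟨q', hq'⟩ := hx q
    exact ⟨q', fun f hf => by simp [hq f hf, hq' f hf]⟩

section EE

variable {H : Type*} [NormedAddCommGroup H] [InnerProductSpace ℂ H]
variable {J : Type*} [DecidableEq J]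

def efstL : FockE H J →ₗ[ℂ] H where
  toFun := efst
  map_add' _ _ := rfl
  map_smul' _ _ := rfl

def esndL (w : List J) : FockE H J →ₗ[ℂ] H where
  toFun ζ := esnd ζ w
  map_add' _ _ := rfl
  map_smul' _ _ := rfl

lemma efst_eq (ζ : FockE H J) : efst ζ = efstL ζ := rfl
lemma esnd_eq (ζ : FockE H J) (w : List J) : esnd ζ w = esndL w ζ := rfl

lemma fockE_ext {ζ ζ' : FockE H J} (h1 : efst ζ = efst ζ') (h2 : ∀ w, esnd ζ w = esnd ζ' w) :
    ζ = ζ' := by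
  apply (WithLp.equiv 2 _).injective
  refine Prod.ext h1 ?_
  apply lp.ext
  funext w
  exact h2 w

lemma fockE_inner (ζ ζ' : FockE H J) :
    ⟪ζ, ζ'⟫ = ⟪efst ζ, efst ζ'⟫ + ∑' w, ⟪esnd ζ w, esnd ζ' w⟫ := by
  rw [WithLp.prod_inner_apply, lp.inner_eq_tsum]
  rfl

lemma fockE_summable (ζ ζ' : FockE H J) : Summable fun w => ⟪esnd ζ w, esnd ζ' w⟫ :=
  lp.summable_inner (𝕜 := ℂ) (WithLp.equiv 2 _ ζ).2 (WithLp.equiv 2 _ ζ').2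

lemma inner_Omega (ω : H) (ζ : FockE H J) : ⟪fockOmega J ω, ζ⟫ = ⟪ω, esnd ζ []⟫ := by
  rw [fockOmega, WithLp.prod_inner_apply]
  erw [lp.inner_single_left]
  simp [esnd]

lemma inner_EOmega (ω : H) (ζ : FockE H J) : ⟪fockEOmega J ω, ζ⟫ = ⟪ω, efst ζ⟫ := by
  rw [fockEOmega, WithLp.prod_inner_apply]
  simp [efst]

/-- inner product of `ξ'_{n+1}` with a created vector. -/
lemma inner_xi_cre (ω : H) (hω : ‖ω‖ = 1) {η η' : lp (fun _ : J => ℂ) 2} {n : ℕ}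
    {ξ ξ' : FockE H J} (hξ : IsXi ω η' n ξ) (hξ' : IsXi ω η' (n + 1) ξ')
    {C : FockE H J →L[ℂ] FockE H J} (hC : IsCre ω η C) (v : FockE H J) :
    ⟪ξ', C v⟫ = ⟪η', η⟫ * ⟪ξ, v⟫ := by
  rw [fockE_inner, fockE_inner, hξ.1, hξ'.1, lp.inner_eq_tsum]
  simp only [inner_zero_left, zero_add]
  apply tsum_list_cons
  · simp [(hC v).2.1]
  · intro j w
    rw [(hC v).2.2, hξ'.2, hξ.2]
    by_cases h : w.length = n
    · simp [h, inner_smul_left, inner_smul_right, hω]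
      ring
    · simp [h]
  · exact lp.summable_inner η' η
  · exact fockE_summable ξ v

lemma inner_xi_zero_cre (ω : H) {η η' : lp (fun _ : J => ℂ) 2}
    {ξ : FockE H J} (hξ : IsXi ω η' 0 ξ)
    {C : FockE H J →L[ℂ] FockE H J} (hC : IsCre ω η C) (v : FockE H J) :
    ⟪ξ, C v⟫ = 0 := by
  rw [fockE_inner, hξ.1]
  simp only [inner_zero_left, zero_add]
  convert tsum_zero with w
  rw [hξ.2]
  cases w with
  | nil => simp [(hC v).2.1]
  | cons j w => simp

lemma inner_xi_of_perp (ω : H) {η' : lp (fun _ : J => ℂ) 2} {n : ℕ}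
    {ξ : FockE H J} (hξ : IsXi ω η' n ξ) (v : FockE H J) (hv : ∀ w, ⟪ω, esnd v w⟫ = 0) :
    ⟪ξ, v⟫ = 0 := by
  rw [fockE_inner, hξ.1]
  simp only [inner_zero_left, zero_add]
  convert tsum_zero with w
  rw [hξ.2]
  split_ifs
  · rw [inner_smul_left, hv, mul_zero]
  · simp

lemma xi_zero (ω : H) {η' : lp (fun _ : J => ℂ) 2} {ξ : FockE H J} (hξ : IsXi ω η' 0 ξ) :
    ξ = fockOmega J ω := by
  apply fockE_ext
  · rw [hξ.1]; rfl
  · intro w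
    rw [hξ.2]
    change _ = (lp.single 2 ([] : List J) ω : ∀ _ : List J, H) w
    cases w with
    | nil => simp
    | cons j w => simp

/-- Vectors that are "free of" the index. -/
def goodSub (d : H →L[ℂ] H) (ξ : ℕ → FockE H J) : Submodule ℂ (FockE H J) where
  carrier := {ζ | d (efst ζ) = 0 ∧ (∀ w, d (esnd ζ w) = 0) ∧ ∀ n, ⟪ξ n, ζ⟫ = 0}
  zero_mem' := by
    refine ⟨?_, fun w => ?_, fun n => ?_⟩
    · simp [efst_eq]
    · simp [esnd_eq]
    · simp
  add_mem' := by
    rintro a b ⟨h1, h2, h3⟩ ⟨h1', h2', h3'⟩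
    refine ⟨?_, fun w => ?_, fun n => ?_⟩
    · rw [efst_eq, map_add, map_add, ← efst_eq, ← efst_eq, h1, h1', add_zero]
    · rw [esnd_eq, map_add, map_add, ← esnd_eq, ← esnd_eq, h2, h2', add_zero]
    · rw [inner_add_right, h3, h3', add_zero]
  smul_mem' := by
    rintro r a ⟨h1, h2, h3⟩
    refine ⟨?_, fun w => ?_, fun n => ?_⟩
    · rw [efst_eq, map_smul, map_smul, ← efst_eq, h1, smul_zero]
    · rw [esnd_eq, map_smul, map_smul, ← esnd_eq, h2, smul_zero]
    · rw [inner_smul_right, h3, mul_zero]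

def perpSub (ω : H) : Submodule ℂ (FockE H J) where
  carrier := {ζ | ⟪fockEOmega J ω, ζ⟫ = 0}
  zero_mem' := by simp
  add_mem' := by
    intro a b h h'
    simp only [Set.mem_setOf_eq] at *
    rw [inner_add_right, h, h', add_zero]
  smul_mem' := by
    intro r a h
    simp only [Set.mem_setOf_eq] at *
    rw [inner_smul_right, h, mul_zero]

lemma eomega_good (ω : H) (d : H →L[ℂ] H) (hd : d ω = 0) (ξ : ℕ → FockE H J)
    (η : lp (fun _ : J => ℂ) 2) (hξ : ∀ n, IsXi ω η n (ξ n)) :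
    fockEOmega J ω ∈ goodSub d ξ := by
  have h0 : ∀ w, esnd (fockEOmega J ω) w = 0 := fun w => rfl
  refine ⟨hd, fun w => ?_, fun n => ?_⟩
  · rw [h0, map_zero]
  · apply inner_xi_of_perp ω (hξ n)
    intro w
    rw [h0, inner_zero_right]

lemma embed_coord {ω : H} {a : H →L[ℂ] H} {x : FockE H J →L[ℂ] FockE H J}
    (hx : IsEmbed ω a x) (v : FockE H J) (hv : ⟪fockOmega J ω, v⟫ = 0) :
    efst (x v) = a (efst v) ∧ ∀ w, esnd (x v) w = a (esnd v w) := by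
  have := hx v
  rw [hv, zero_smul, sub_zero] at this
  exact this

lemma embed_Omega {ω : H} (hω : ‖ω‖ = 1) {a : H →L[ℂ] H} {x : FockE H J →L[ℂ] FockE H J}
    (hx : IsEmbed ω a x) : x (fockOmega J ω) = 0 := by
  have h1 : ⟪fockOmega J ω, fockOmega J ω⟫ = (1 : ℂ) := by
    rw [inner_Omega]
    change ⟪ω, (lp.single 2 ([] : List J) ω : ∀ _ : List J, H) []⟫ = (1 : ℂ)
    simp [hω]
  have := hx (fockOmega J ω)
  rw [h1, one_smul, sub_self] at this
  apply fockE_ext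
  · rw [this.1, efst_eq, map_zero, map_zero]
  · intro w
    rw [this.2, esnd_eq, map_zero, map_zero]

section OneSide

variable (ω : H) (c d : H →L[ℂ] H)
  (K : FockE H J →L[ℂ] FockE H J)

/-- coordinates of powers of `K` -/
lemma K_perp (hωc : ∀ f, ⟪ω, c f⟫ = 0) (hK : IsEmbed ω c K) (v : FockE H J) :
    (∀ w, ⟪ω, esnd (K v) w⟫ = 0) ∧ ⟪ω, efst (K v)⟫ = 0 := by
  refine ⟨fun w => ?_, ?_⟩
  · rw [(hK v).2, hωc]
  · rw [(hK v).1, hωc]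

lemma K_pow_coord (hωc : ∀ f, ⟪ω, c f⟫ = 0) (hK : IsEmbed ω c K) (v : FockE H J)
    (hv : ⟪fockOmega J ω, v⟫ = 0) (m : ℕ) :
    ⟪fockOmega J ω, (K ^ m) v⟫ = 0 ∧ efst ((K ^ m) v) = (c ^ m) (efst v) ∧
      ∀ w, esnd ((K ^ m) v) w = (c ^ m) (esnd v w) := by
  induction m with
  | zero => simpa using hv
  | succ m ih =>
    simp only [pow_succ', ContinuousLinearMap.mul_apply]
    obtain ⟨h1, h2, h3⟩ := ih
    have := embed_coord hK _ h1
    refine ⟨?_, ?_, fun w => ?_⟩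
    · rw [inner_Omega]
      exact (K_perp ω c K hωc hK _).1 _
    · rw [this.1, h2]
    · rw [this.2, h3]

lemma aeval_K_coord (hωc : ∀ f, ⟪ω, c f⟫ = 0) (hK : IsEmbed ω c K) (v : FockE H J)
    (hv : ⟪fockOmega J ω, v⟫ = 0) (q : Polynomial ℂ) :
    efst (Polynomial.aeval K q v) = Polynomial.aeval c q (efst v) ∧
      ∀ w, esnd (Polynomial.aeval K q v) w = Polynomial.aeval c q (esnd v w) := by
  induction q using Polynomial.induction_on' with
  | add p q hp hq =>
    refine ⟨?_, fun w => ?_⟩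
    · simp only [map_add, ContinuousLinearMap.add_apply, ← hp.1, ← hq.1]
      rfl
    · simp only [map_add, ContinuousLinearMap.add_apply, ← hp.2, ← hq.2]
      rfl
  | monomial n r =>
    have := K_pow_coord ω c K hωc hK v hv n
    simp only [Polynomial.aeval_monomial, Algebra.algebraMap_eq_smul_one, smul_mul_assoc, one_mul,
      ContinuousLinearMap.smul_apply]
    refine ⟨?_, fun w => ?_⟩
    · rw [← this.2.1]; rfl
    · rw [← this.2.2]; rfl

/-- Action of `Π(a)` on `K^m v`. -/
lemma embed_poly (hdc : ∀ f, d (c f) = f) (hωc : ∀ f, ⟪ω, c f⟫ = 0) (hK : IsEmbed ω c K)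
    (a : H →L[ℂ] H) (ha : a ∈ Algebra.adjoin ℂ {c, d})
    (x : FockE H J →L[ℂ] FockE H J) (hx : IsEmbed ω a x) (m : ℕ) :
    ∃ q : Polynomial ℂ, ∀ v : FockE H J, ⟪fockOmega J ω, v⟫ = 0 → d (efst v) = 0 →
      (∀ w, d (esnd v w) = 0) → x ((K ^ m) v) = Polynomial.aeval K q v := by
  obtain ⟨q, hq⟩ := toeplitz_poly c d hdc a ha (Polynomial.X ^ m)
  simp only [map_pow, Polynomial.aeval_X] at hq
  refine ⟨q, fun v hv h1 h2 => ?_⟩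
  obtain ⟨g1, g2, g3⟩ := K_pow_coord ω c K hωc hK v hv m
  obtain ⟨k1, k2⟩ := aeval_K_coord ω c K hωc hK v hv q
  obtain ⟨l1, l2⟩ := embed_coord hx _ g1
  apply fockE_ext
  · rw [l1, g2, k1, hq _ h1]
  · intro w
    rw [l2, g3, k2, hq _ (h2 w)]

lemma C_K_zero (hωc : ∀ f, ⟪ω, c f⟫ = 0) (hK : IsEmbed ω c K) {η : lp (fun _ : J => ℂ) 2}
    {C : FockE H J →L[ℂ] FockE H J} (hC : IsCre ω η C) (v : FockE H J) : C (K v) = 0 := by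
  have h := (K_perp ω c K hωc hK v).1
  apply fockE_ext
  · rw [(hC _).1]; rfl
  · intro w
    cases w with
    | nil => rw [(hC _).2.1]; rfl
    | cons j w => rw [(hC _).2.2, h, zero_smul, smul_zero]; rfl

lemma cre_kill (hd : d ω = 0) {η : lp (fun _ : J => ℂ) 2}
    {C : FockE H J →L[ℂ] FockE H J} (hC : IsCre ω η C) (v : FockE H J) :
    d (efst (C v)) = 0 ∧ (∀ w, d (esnd (C v) w) = 0) ∧ ⟪fockOmega J ω, C v⟫ = 0 ∧
      ⟪fockEOmega J ω, C v⟫ = 0 := by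
  refine ⟨?_, fun w => ?_, ?_, ?_⟩
  · rw [(hC v).1, map_zero]
  · cases w with
    | nil => rw [(hC _).2.1, map_zero]
    | cons j w => rw [(hC _).2.2, map_smul, map_smul, hd, smul_zero, smul_zero]
  · rw [inner_Omega, (hC v).2.1, inner_zero_right]
  · rw [inner_EOmega, (hC v).1, inner_zero_right]

/-- One-sided main lemma. `c, d, C, An` belong to the index at hand, `d', ξ'` to the other. -/
lemma one_side (hω : ‖ω‖ = 1) (hdc : ∀ f, d (c f) = f) (hdω : d ω = 0)
    (hωc : ∀ f, ⟪ω, c f⟫ = 0)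
    (d' : H →L[ℂ] H) (hd'c : ∀ f, d' (c f) = 0) (hd'ω : d' ω = 0)
    (Pi : (H →L[ℂ] H) → (FockE H J →L[ℂ] FockE H J)) (hPi : ∀ a, IsEmbed ω a (Pi a))
    (η η' : lp (fun _ : J => ℂ) 2) (hη : ⟪η', η⟫ = 0)
    (C : FockE H J →L[ℂ] FockE H J) (hC : IsCre ω η C)
    (An : ℕ → (FockE H J →L[ℂ] FockE H J))
    (ξ ξ' : ℕ → FockE H J) (hξ : ∀ n, IsXi ω η n (ξ n)) (hξ' : ∀ n, IsXi ω η' n (ξ' n))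
    (hAn : ∀ n ζ, An n ζ = ⟪ξ n, ζ⟫ • fockOmega J ω)
    (x : FockE H J →L[ℂ] FockE H J)
    (hx : x ∈ Algebra.adjoin ℂ
      ((Pi '' ((Algebra.adjoin ℂ {c, d} : Subalgebra ℂ (H →L[ℂ] H)) : Set (H →L[ℂ] H))) ∪
          ({C} ∪ Set.range An))) :
    (fockPsi J ω x = 0 → ∀ ζ ∈ goodSub d ξ, x ζ ∈ goodSub d' ξ' ⊓ perpSub ω) ∧
    ∃ r : ℂ, x (fockOmega J ω) - r • fockOmega J ω ∈ goodSub d' ξ' ⊓ perpSub ω := by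
  have hK := hPi c
  set K := Pi c with hKdef
  have hC' : ∀ v, C v ∈ goodSub d' ξ' ⊓ perpSub ω := by
    intro v
    obtain ⟨h1, h2, h3, h4⟩ := cre_kill ω d' hd'ω hC v
    refine ⟨⟨h1, h2, fun n => ?_⟩, h4⟩
    cases n with
    | zero => exact inner_xi_zero_cre ω (hξ' 0) hC v
    | succ n => rw [inner_xi_cre ω hω (hξ' n) (hξ' (n + 1)) hC, hη, zero_mul]
  have hK' : ∀ v, K v ∈ goodSub d' ξ' ⊓ perpSub ω := by
    intro v
    obtain ⟨h1, h2⟩ := K_perp ω c K hωc hK v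
    refine ⟨⟨?_, fun w => ?_, fun n => inner_xi_of_perp ω (hξ' n) _ h1⟩, ?_⟩
    · rw [(hK v).1, hd'c]
    · rw [(hK v).2, hd'c]
    · change ⟪_, _⟫ = (0 : ℂ)
      rw [inner_EOmega, h2]
  have hKC : ∀ m l v, (m, l) ≠ (0, 0) → (K ^ m) ((C ^ l) v) ∈ goodSub d' ξ' ⊓ perpSub ω := by
    intro m l v h
    cases m with
    | succ m =>
      rw [pow_succ', ContinuousLinearMap.mul_apply]
      exact hK' _
    | zero =>
      cases l with
      | zero => exact absurd rfl h
      | succ l =>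
        rw [pow_zero, ContinuousLinearMap.one_apply, pow_succ', ContinuousLinearMap.mul_apply]
        exact hC' _
  have hgoodC : ∀ l, ∀ ζ ∈ goodSub d ξ, (C ^ l) ζ ∈ goodSub d ξ := by
    intro l ζ hζ
    induction l with
    | zero => simpa using hζ
    | succ l ih =>
      rw [pow_succ', ContinuousLinearMap.mul_apply]
      obtain ⟨h1, h2, h3, h4⟩ := cre_kill ω d hdω hC ((C ^ l) ζ)
      refine ⟨h1, h2, fun n => ?_⟩
      cases n with
      | zero => exact inner_xi_zero_cre ω (hξ 0) hC _
      | succ n => rw [inner_xi_cre ω hω (hξ n) (hξ (n + 1)) hC, ih.2.2 n, mul_zero]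
  have hgoodK : ∀ m, ∀ ζ ∈ goodSub d ξ, ∀ n, ⟪ξ n, (K ^ m) ζ⟫ = 0 := by
    intro m ζ hζ n
    cases m with
    | zero => simpa using hζ.2.2 n
    | succ m =>
      rw [pow_succ', ContinuousLinearMap.mul_apply]
      exact inner_xi_of_perp ω (hξ n) _ (K_perp ω c K hωc hK _).1
  have hOm : ∀ ζ ∈ goodSub d ξ, ⟪fockOmega J ω, ζ⟫ = 0 := by
    intro ζ hζ
    rw [← xi_zero ω (hξ 0)]
    exact hζ.2.2 0
  constructor
  · -- centered elements acting on good vectors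
    let N : Submodule ℂ (goodSub d ξ → FockE H J) :=
      Submodule.span ℂ (Set.range fun (p : ℕ × ℕ) (ζ : goodSub d ξ) => (K ^ p.1) ((C ^ p.2) ζ.1))
    have hgen : ∀ m l, (fun ζ : goodSub d ξ => (K ^ m) ((C ^ l) ζ.1)) ∈ N :=
      fun m l => Submodule.subset_span ⟨(m, l), rfl⟩
    have key : ∀ y : FockE H J →L[ℂ] FockE H J,
        (∀ m l, (fun ζ : goodSub d ξ => y ((K ^ m) ((C ^ l) ζ.1))) ∈ N) →
        ∀ F ∈ N, (fun ζ => y (F ζ)) ∈ N := by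
      intro y hy F hF
      induction hF using Submodule.span_induction with
      | mem F hF =>
        obtain ⟨⟨m, l⟩, rfl⟩ := hF
        exact hy m l
      | zero =>
        convert N.zero_mem using 1
        funext ζ
        simp
      | add F G _ _ hF hG =>
        have := N.add_mem hF hG
        convert this using 1
        funext ζ
        simp
      | smul r F _ hF =>
        have := N.smul_mem r hF
        convert this using 1
        funext ζ
        simp
    have hinv : ∀ F ∈ N, (fun ζ => x (F ζ)) ∈ N := by
      induction hx using Algebra.adjoin_induction with
      | mem y hy =>
        apply key
        intro m l
        rcases hy with ⟨a, ha, rfl⟩ | rfl | ⟨n, rfl⟩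
        · obtain ⟨q, hq⟩ := embed_poly ω c d K hdc hωc hK a ha (Pi a) (hPi a) m
          have : (fun ζ : goodSub d ξ => Pi a ((K ^ m) ((C ^ l) ζ.1))) =
              ∑ i ∈ Finset.range (q.natDegree + 1),
                q.coeff i • (fun ζ : goodSub d ξ => (K ^ i) ((C ^ l) ζ.1)) := by
            funext ζ
            have hg := hgoodC l ζ.1 ζ.2
            rw [hq _ (hOm _ hg) hg.1 hg.2.1, Polynomial.aeval_eq_sum_range]
            simp [ContinuousLinearMap.sum_apply]
          rw [this]
          exact N.sum_mem fun i _ => N.smul_mem _ (hgen i l)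
        · cases m with
          | zero =>
            have := hgen 0 (l + 1)
            simpa [pow_succ'] using this
          | succ m =>
            convert N.zero_mem using 1
            funext ζ
            rw [pow_succ', ContinuousLinearMap.mul_apply]
            exact C_K_zero ω c K hωc hK hC _
        · convert N.zero_mem using 1
          funext ζ
          rw [hAn, hgoodK m _ (hgoodC l ζ.1 ζ.2), zero_smul]
          rfl
      | algebraMap r =>
        intro F hF
        have := N.smul_mem r hF
        convert this using 1
        funext ζ
        simp [Algebra.algebraMap_eq_smul_one]
      | add y z _ _ hy hz =>
        intro F hF
        exact N.add_mem (hy F hF) (hz F hF)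
      | mul y z _ _ hy hz =>
        intro F hF
        exact hy _ (hz F hF)
    have hN : ∀ F ∈ N, ∃ r : ℂ, ∀ ζ : goodSub d ξ,
        F ζ - r • ζ.1 ∈ goodSub d' ξ' ⊓ perpSub ω := by
      intro F hF
      induction hF using Submodule.span_induction with
      | mem F hF =>
        obtain ⟨⟨m, l⟩, rfl⟩ := hF
        by_cases h : (m, l) = (0, 0)
        · refine ⟨1, fun ζ => ?_⟩
          obtain ⟨rfl, rfl⟩ := Prod.mk.inj h
          simpa using Submodule.zero_mem _
        · refine ⟨0, fun ζ => ?_⟩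
          rw [zero_smul, sub_zero]
          exact hKC m l _ h
      | zero => exact ⟨0, fun ζ => by simpa using Submodule.zero_mem _⟩
      | add F G _ _ hF hG =>
        obtain ⟨r, hr⟩ := hF
        obtain ⟨s, hs⟩ := hG
        refine ⟨r + s, fun ζ => ?_⟩
        have := Submodule.add_mem _ (hr ζ) (hs ζ)
        convert this using 1
        change F ζ + G ζ - (r + s) • ζ.1 = _
        module
      | smul t F _ hF =>
        obtain ⟨r, hr⟩ := hF
        refine ⟨t * r, fun ζ => ?_⟩
        have := Submodule.smul_mem _ t (hr ζ)
        convert this using 1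
        change t • F ζ - (t * r) • ζ.1 = _
        module
    have hid : (fun ζ : goodSub d ξ => ζ.1) ∈ N := by simpa using hgen 0 0
    obtain ⟨r, hr⟩ := hN _ (hinv _ hid)
    intro hψ ζ hζ
    have he := (hr ⟨_, eomega_good ω d hdω ξ η hξ⟩).2
    have hr0 : r = 0 := by
      change ⟪fockEOmega J ω, x (fockEOmega J ω) - r • fockEOmega J ω⟫ = 0 at he
      have h1 : ⟪fockEOmega J ω, fockEOmega J ω⟫ = (1 : ℂ) := by
        rw [inner_EOmega]
        change ⟪ω, ω⟫ = (1 : ℂ)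
        simp [hω]
      rw [inner_sub_right, inner_smul_right, h1] at he
      change fockPsi J ω x - _ = 0 at he
      rw [hψ] at he
      simpa using he
    have := hr ⟨ζ, hζ⟩
    rwa [hr0, zero_smul, sub_zero] at this
  · -- action on Ω
    let V : Submodule ℂ (FockE H J) := Submodule.span ℂ
      ({fockOmega J ω} ∪ Set.range fun p : ℕ × ℕ => (K ^ p.1) ((C ^ (p.2 + 1)) (fockOmega J ω)))
    have hΩ : fockOmega J ω ∈ V := Submodule.subset_span (Or.inl rfl)
    have hgen : ∀ m l, (K ^ m) ((C ^ (l + 1)) (fockOmega J ω)) ∈ V :=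
      fun m l => Submodule.subset_span (Or.inr ⟨(m, l), rfl⟩)
    have hinv : ∀ v ∈ V, x v ∈ V := by
      induction hx using Algebra.adjoin_induction with
      | mem y hy =>
        intro v hv
        induction hv using Submodule.span_induction with
        | zero => simpa using V.zero_mem
        | add u v _ _ hu hv => rw [map_add]; exact V.add_mem hu hv
        | smul r u _ hu => rw [map_smul]; exact V.smul_mem r hu
        | mem v hv =>
          rcases hy with ⟨a, ha, rfl⟩ | rfl | ⟨n, rfl⟩
          · rcases hv with rfl | ⟨⟨m, l⟩, rfl⟩
            · rw [embed_Omega hω (hPi a)]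
              exact V.zero_mem
            · obtain ⟨q, hq⟩ := embed_poly ω c d K hdc hωc hK a ha (Pi a) (hPi a) m
              obtain ⟨h1, h2, h3, h4⟩ := cre_kill ω d hdω hC ((C ^ l) (fockOmega J ω))
              rw [← ContinuousLinearMap.mul_apply, ← pow_succ'] at h1 h3
              simp only [← ContinuousLinearMap.mul_apply, ← pow_succ'] at h2
              simp only
              rw [hq _ h3 h1 h2, Polynomial.aeval_eq_sum_range, ContinuousLinearMap.sum_apply]
              exact V.sum_mem fun i _ => V.smul_mem _ (hgen i l)
          · rcases hv with rfl | ⟨⟨m, l⟩, rfl⟩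
            · simpa using hgen 0 0
            · cases m with
              | zero =>
                have := hgen 0 (l + 1)
                simpa [pow_succ' _ (l + 1)] using this
              | succ m =>
                simp only
                rw [pow_succ', ContinuousLinearMap.mul_apply, C_K_zero ω c K hωc hK hC]
                exact V.zero_mem
          · rw [hAn]
            exact V.smul_mem _ hΩ
      | algebraMap r =>
        intro v hv
        exact V.smul_mem r hv
      | add y z _ _ hy hz =>
        intro v hv
        exact V.add_mem (hy v hv) (hz v hv)
      | mul y z _ _ hy hz =>
        intro v hv
        exact hy _ (hz v hv)
    have hV : ∀ v ∈ V, ∃ r : ℂ, v - r • fockOmega J ω ∈ goodSub d' ξ' ⊓ perpSub ω := by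
      intro v hv
      induction hv using Submodule.span_induction with
      | mem v hv =>
        rcases hv with rfl | ⟨⟨m, l⟩, rfl⟩
        · exact ⟨1, by simpa using Submodule.zero_mem _⟩
        · refine ⟨0, ?_⟩
          rw [zero_smul, sub_zero]
          exact hKC m (l + 1) _ (by simp)
      | zero => exact ⟨0, by simpa using Submodule.zero_mem _⟩
      | add u v _ _ hu hv =>
        obtain ⟨r, hr⟩ := hu
        obtain ⟨s, hs⟩ := hv
        refine ⟨r + s, ?_⟩
        have := Submodule.add_mem _ hr hs
        convert this using 1
        module
      | smul t u _ hu =>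
        obtain ⟨r, hr⟩ := hu
        refine ⟨t * r, ?_⟩
        have := Submodule.smul_mem _ t hr
        convert this using 1
        module
    exact hV _ (hinv _ hΩ)

end OneSide

end EE

/-- Abstract c-freeness criterion. -/
lemma cfree_abstract {E : Type*} [NormedAddCommGroup E] [InnerProductSpace ℂ E]
    (A : Fin 2 → Subalgebra ℂ (E →L[ℂ] E)) (u Ω : E) (hΩ : ⟪Ω, Ω⟫ = (1 : ℂ))
    (G G' : Fin 2 → Submodule ℂ E)
    (h1 : ∀ i, ∀ x ∈ A i, ⟪u, x u⟫ = 0 → ∀ ζ ∈ G i, x ζ ∈ G' i)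
    (h2 : ∀ i k, i ≠ k → G' i ≤ G k) (h3 : ∀ i, u ∈ G i)
    (h4 : ∀ i, ∀ ζ ∈ G' i, ⟪u, ζ⟫ = 0) (h6 : ∀ i, ∀ ζ ∈ G' i, ⟪Ω, ζ⟫ = 0)
    (h5 : ∀ i, ∀ x ∈ A i, ∃ r : ℂ, x Ω - r • Ω ∈ G' i) :
    IsCFreePair (fun x : E →L[ℂ] E => ⟪Ω, x Ω⟫) (fun x : E →L[ℂ] E => ⟪u, x u⟫) (A 0) (A 1) := by
  have hA : ∀ (i : Fin 2) (y : E →L[ℂ] E), y ∈ (if i = 0 then A 0 else A 1) → y ∈ A i := by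
    intro i y hy
    fin_cases i <;> simpa using hy
  have h5' : ∀ i, ∀ x ∈ A i, x Ω - ⟪Ω, x Ω⟫ • Ω ∈ G' i := by
    intro i x hx
    obtain ⟨r, hr⟩ := h5 i x hx
    have := h6 i _ hr
    rw [inner_sub_right, inner_smul_right, hΩ, mul_one, sub_eq_zero] at this
    rwa [this]
  have A1 : ∀ (n : ℕ) (ε : Fin (n + 1) → Fin 2) (x : Fin (n + 1) → E →L[ℂ] E),
      (∀ j, x j ∈ A (ε j)) →
      (∀ (j : ℕ) (h : j + 1 < n + 1), ε ⟨j, Nat.lt_of_succ_lt h⟩ ≠ ε ⟨j + 1, h⟩) →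
      (∀ j, ⟪u, x j u⟫ = 0) →
      (List.ofFn x).prod u ∈ G' (ε 0) ∧
      (List.ofFn x).prod Ω - (∏ j, ⟪Ω, x j Ω⟫) • Ω ∈ G' (ε 0) := by
    intro n
    induction n with
    | zero =>
      intro ε x hx _ hc
      simp only [List.ofFn_succ, List.ofFn_zero, List.prod_cons, List.prod_nil, mul_one,
        Fin.prod_univ_succ, Fin.prod_univ_zero]
      exact ⟨h1 _ _ (hx 0) (hc 0) _ (h3 _), h5' _ _ (hx 0)⟩
    | succ n ih =>
      intro ε x hx ha hc
      obtain ⟨i1, i2⟩ := ih (fun j => ε j.succ) (fun j => x j.succ) (fun j => hx _)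
        (fun j h => ha (j + 1) (by omega)) (fun j => hc _)
      have hne : ε (Fin.succ 0) ≠ ε 0 := (ha 0 (by omega)).symm
      have j1 := h1 _ _ (hx 0) (hc 0) _ (h2 _ _ hne i1)
      have j2 := h1 _ _ (hx 0) (hc 0) _ (h2 _ _ hne i2)
      rw [List.ofFn_succ, List.prod_cons, Fin.prod_univ_succ]
      refine ⟨j1, ?_⟩
      have := Submodule.add_mem _ j2
        (Submodule.smul_mem _ (∏ j : Fin (n + 1), ⟪Ω, x j.succ Ω⟫) (h5' _ _ (hx 0)))
      convert this using 1
      rw [map_sub, map_smul, ContinuousLinearMap.mul_apply]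
      module
  constructor
  · intro n ε x hn hx ha hc
    obtain ⟨n, rfl⟩ : ∃ m, n = m + 1 := ⟨n - 1, by omega⟩
    exact h4 _ _ (A1 n ε x (fun j => hA _ _ (hx j)) ha hc).1
  · intro n ε x hn hx ha hc
    obtain ⟨n, rfl⟩ : ∃ m, n = m + 1 := ⟨n - 1, by omega⟩
    have := h6 _ _ (A1 n ε x (fun j => hA _ _ (hx j)) ha hc).2
    rw [inner_sub_right, inner_smul_right, hΩ, mul_one, sub_eq_zero] at this
    exact this

end Helpers

/-- Corollary 2.5 of the paper: taking `ℋ := 𝔽(I)` (the full Fock space over `I`, with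
`ω` the vacuum vector), the algebras generated by `π(𝒜(e₁)) ∪ 𝒟(η₁)` and by
`π(𝒜(e₂)) ∪ 𝒟(η₂)` are c-free with respect to `(φ, ψ)`. -/
theorem cfree_fock_model_full_fock
    {I : Type*} [DecidableEq I] [Nontrivial I] {J : Type*} [DecidableEq J]
    (e₁ e₂ : lp (fun _ : I => ℂ) 2) (he₁ : ‖e₁‖ = 1) (he₂ : ‖e₂‖ = 1)
    (horthe : ⟪e₁, e₂⟫ = 0)
    (η₁ η₂ : lp (fun _ : J => ℂ) 2) (hη₁ : ‖η₁‖ = 1) (hη₂ : ‖η₂‖ = 1)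
    (horthη : ⟪η₁, η₂⟫ = 0)
    (c₁ c₂ : FFock I →L[ℂ] FFock I) (hc₁ : IsCreF e₁ c₁) (hc₂ : IsCreF e₂ c₂)
    (Pi : (FFock I →L[ℂ] FFock I) → (FockE (FFock I) J →L[ℂ] FockE (FFock I) J))
    (hPi : ∀ a, IsEmbed (fockVac I) a (Pi a))
    (C₁ C₂ : FockE (FFock I) J →L[ℂ] FockE (FFock I) J)
    (hC₁ : IsCre (fockVac I) η₁ C₁) (hC₂ : IsCre (fockVac I) η₂ C₂)
    (An₁ An₂ : ℕ → (FockE (FFock I) J →L[ℂ] FockE (FFock I) J))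
    (hAn₁ : ∀ n, IsAnn (fockVac I) η₁ n (An₁ n))
    (hAn₂ : ∀ n, IsAnn (fockVac I) η₂ n (An₂ n)) :
    IsCFreePair (fockPhi J (fockVac I)) (fockPsi J (fockVac I))
      (Algebra.adjoin ℂ
        ((Pi '' ((Algebra.adjoin ℂ {c₁, ContinuousLinearMap.adjoint c₁} :
            Subalgebra ℂ (FFock I →L[ℂ] FFock I)) : Set (FFock I →L[ℂ] FFock I))) ∪
          ({C₁} ∪ Set.range An₁)))
      (Algebra.adjoin ℂ
        ((Pi '' ((Algebra.adjoin ℂ {c₂, ContinuousLinearMap.adjoint c₂} :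
            Subalgebra ℂ (FFock I →L[ℂ] FFock I)) : Set (FFock I →L[ℂ] FFock I))) ∪
          ({C₂} ∪ Set.range An₂))) := by
  classical
  have hω : ‖fockVac I‖ = 1 := by
    rw [fockVac, lp.norm_single (by norm_num)]
    simp
  choose ξ₁ hξ₁ hA₁ using hAn₁
  choose ξ₂ hξ₂ hA₂ using hAn₂
  have hn₁ : ⟪e₁, e₁⟫ = (1 : ℂ) := by simp [he₁]
  have hn₂ : ⟪e₂, e₂⟫ = (1 : ℂ) := by simp [he₂]
  have horthe' : ⟪e₂, e₁⟫ = 0 := inner_eq_zero_symm.mp horthe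
  have horthη' : ⟪η₂, η₁⟫ = 0 := inner_eq_zero_symm.mp horthη
  have hd₁ := adj_creF_vac hc₁
  have hd₂ := adj_creF_vac hc₂
  have s₁ := one_side (J := J) (fockVac I) c₁ (ContinuousLinearMap.adjoint c₁) hω
    (fun f => by rw [adj_creF_creF hc₁ hc₁, hn₁, one_smul]) hd₁
    (fun f => by rw [inner_vac, (hc₁ f).1])
    (ContinuousLinearMap.adjoint c₂)
    (fun f => by rw [adj_creF_creF hc₂ hc₁, horthe', zero_smul]) hd₂
    Pi hPi η₁ η₂ horthη' C₁ hC₁ An₁ ξ₁ ξ₂ hξ₁ hξ₂ hA₁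
  have s₂ := one_side (J := J) (fockVac I) c₂ (ContinuousLinearMap.adjoint c₂) hω
    (fun f => by rw [adj_creF_creF hc₂ hc₂, hn₂, one_smul]) hd₂
    (fun f => by rw [inner_vac, (hc₂ f).1])
    (ContinuousLinearMap.adjoint c₁)
    (fun f => by rw [adj_creF_creF hc₁ hc₂, horthe, zero_smul]) hd₁
    Pi hPi η₂ η₁ horthη C₂ hC₂ An₂ ξ₂ ξ₁ hξ₂ hξ₁ hA₂
  have hΩ : ⟪fockOmega J (fockVac I), fockOmega J (fockVac I)⟫ = (1 : ℂ) := by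
    rw [inner_Omega]
    change ⟪fockVac I, (lp.single 2 ([] : List J) (fockVac I) : ∀ _ : List J, FFock I) []⟫ = (1 : ℂ)
    simp [hω]
  refine cfree_abstract ![_, _] (fockEOmega J (fockVac I)) (fockOmega J (fockVac I)) hΩ
    ![goodSub (ContinuousLinearMap.adjoint c₁) ξ₁, goodSub (ContinuousLinearMap.adjoint c₂) ξ₂]
    ![goodSub (ContinuousLinearMap.adjoint c₂) ξ₂ ⊓ perpSub (fockVac I),
      goodSub (ContinuousLinearMap.adjoint c₁) ξ₁ ⊓ perpSub (fockVac I)] ?_ ?_ ?_ ?_ ?_ ?_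
  · rw [Fin.forall_fin_two]
    exact ⟨fun x hx => (s₁ x hx).1, fun x hx => (s₂ x hx).1⟩
  · simp only [Fin.forall_fin_two]
    exact ⟨⟨fun h => absurd rfl h, fun _ => inf_le_left⟩,
      ⟨fun _ => inf_le_left, fun h => absurd rfl h⟩⟩
  · rw [Fin.forall_fin_two]
    exact ⟨eomega_good _ _ hd₁ _ η₁ hξ₁, eomega_good _ _ hd₂ _ η₂ hξ₂⟩
  · rw [Fin.forall_fin_two]
    exact ⟨fun ζ h => h.2, fun ζ h => h.2⟩
  · rw [Fin.forall_fin_two]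
    refine ⟨fun ζ h => ?_, fun ζ h => ?_⟩
    · rw [← xi_zero _ (hξ₂ 0)]
      exact h.1.2.2 0
    · rw [← xi_zero _ (hξ₁ 0)]
      exact h.1.2.2 0
  · rw [Fin.forall_fin_two]
    exact ⟨fun x hx => (s₁ x hx).2, fun x hx => (s₂ x hx).2⟩
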